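/- For every α' ∈ Δ̇', every n ≥ 1, and every x ∈ 𝒮̇ₙ, the reflected vector r_{α'}(x) lies in 𝒮̇ₙ₊₁'. -/

import Mathlib

noncomputable section

/-- The golden ratio τ = (1+√5)/2. -/
def gr : ℝ := (1 + Real.sqrt 5) / 2

/-- The ring ℤ[τ] as a subset of ℝ. -/
def Ztau : Set ℝ := {x : ℝ | ∃ a b : ℤ, x = (a : ℝ) + (b : ℝ) * gr}

/-- Congruence modulo 2ℤ[τ]. -/
def cong2 (x y : ℝ) : Prop := ∃ a b : ℤ, x - y = 2 * ((a : ℝ) + (b : ℝ) * gr)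

/-- The vector (0, 1, τ', τ) (for t = τ; its conjugate for t = τ'). -/
def v4 (t : ℝ) : Fin 4 → ℝ := ![0, 1, 1 - t, t]

/-- Representatives of the four classes of 𝔽₄ = ℤ[τ]/2ℤ[τ]. -/
def Reps : Set ℝ := {0, 1, gr, 1 + gr}

/-- `y` reduces mod 2ℤ[τ]⁴ into the 𝔽₄-span A of (1,1,1,1) and (0,1,τ',τ). -/
def inAmod (t : ℝ) (y : Fin 4 → ℝ) : Prop :=
  ∃ c ∈ Reps, ∃ d ∈ Reps, ∀ i, cong2 (y i) (c + d * v4 t i)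

/-- `y` reduces mod 2ℤ[τ]⁴ into Ȧ, the images of even permutations of (0,1,τ',τ). -/
def inAdot (t : ℝ) (y : Fin 4 → ℝ) : Prop :=
  ∃ σ : Equiv.Perm (Fin 4), Equiv.Perm.sign σ = 1 ∧ ∀ i, cong2 (y i) (v4 t (σ i))

/-- The spherical sets 𝒮ₙ (t = τ) resp. 𝒮ₙ' (t = τ'). -/
def sphS (t : ℝ) : ℕ → Set (Fin 4 → ℝ)
  | 0 => {x | ∃ i, (x i = 1 ∨ x i = -1) ∧ ∀ j, j ≠ i → x j = 0}
  | (n+1) => {x | (∑ i, x i ^ 2) = 1 ∧ (∀ i, 2 ^ (n+1) * x i ∈ Ztau) ∧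
      inAmod t (fun i => 2 ^ (n+1) * x i) ∧ ∃ i, ¬ cong2 (2 ^ (n+1) * x i) 0}

/-- The spherical sets 𝒮̇ₙ (t = τ) resp. 𝒮̇ₙ' (t = τ'). -/
def sphSdot (t : ℝ) (n : ℕ) : Set (Fin 4 → ℝ) :=
  {x | (∑ i, x i ^ 2) = 1 ∧ (∀ i, 2 ^ n * x i ∈ Ztau) ∧
    inAdot t (fun i => 2 ^ n * x i)}

/-- The H₄ root system with parameter t (t = τ gives Δ, t = 1-τ = τ' gives Δ'). -/
def DeltaSet (t : ℝ) : Set (Fin 4 → ℝ) :=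
  {x | (∃ i, (x i = 1 ∨ x i = -1) ∧ ∀ j, j ≠ i → x j = 0)
    ∨ (∀ i, x i = 1/2 ∨ x i = -1/2)
    ∨ (∃ σ : Equiv.Perm (Fin 4), Equiv.Perm.sign σ = 1 ∧
        ∃ ε : Fin 4 → ℝ, (∀ i, ε i = 1 ∨ ε i = -1) ∧
          ∀ i, x i = ε i * (![0, 1, 1 - t, t] (σ i)) / 2)}

/-- K = Δ ∩ Δ', the rational roots. -/
def Kset : Set (Fin 4 → ℝ) := DeltaSet gr ∩ DeltaSet (1 - gr)

/-- The orthogonal reflection in the hyperplane orthogonal to the unit vector `a`: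
`x ↦ x - 2(x·a)a`. -/
def reflv (a x : Fin 4 → ℝ) : Fin 4 → ℝ := fun i => x i - 2 * (∑ j, x j * a j) * a i

theorem gr_sq : gr ^ 2 = gr + 1 := by
  have h := Real.sq_sqrt (show (0 : ℝ) ≤ 5 by norm_num)
  unfold gr
  linear_combination h / 4

/-- The ring ℤ[τ] as a subring of ℝ. -/
def zTau : Subring ℝ where
  carrier := Ztau
  mul_mem' := by
    rintro _ _ ⟨a, b, rfl⟩ ⟨c, d, rfl⟩
    refine ⟨a * c + b * d, a * d + b * c + b * d, ?_⟩
    push_cast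
    linear_combination (b * d : ℝ) * gr_sq
  one_mem' := ⟨1, 0, by simp⟩
  add_mem' := by
    rintro _ _ ⟨a, b, rfl⟩ ⟨c, d, rfl⟩
    exact ⟨a + c, b + d, by push_cast; ring⟩
  zero_mem' := ⟨0, 0, by simp⟩
  neg_mem' := by
    rintro _ ⟨a, b, rfl⟩
    exact ⟨-a, -b, by push_cast; ring⟩

theorem gr_mem_zTau : gr ∈ zTau := ⟨0, 1, by simp⟩

theorem cong2_iff {x y : ℝ} : cong2 x y ↔ ∃ r ∈ zTau, x - y = 2 * r := by
  constructor
  · rintro ⟨a, b, h⟩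
    exact ⟨_, ⟨a, b, rfl⟩, h⟩
  · rintro ⟨_, ⟨a, b, rfl⟩, h⟩
    exact ⟨a, b, h⟩

theorem cong2_refl (x : ℝ) : cong2 x x := cong2_iff.2 ⟨0, zTau.zero_mem, by ring⟩

theorem cong2_trans {x y z : ℝ} (h₁ : cong2 x y) (h₂ : cong2 y z) : cong2 x z := by
  obtain ⟨r, hr, h⟩ := cong2_iff.1 h₁
  obtain ⟨s, hs, k⟩ := cong2_iff.1 h₂
  exact cong2_iff.2 ⟨r + s, zTau.add_mem hr hs, by linear_combination h + k⟩

theorem cong2_neg {x y : ℝ} (h : cong2 x y) : cong2 (-x) (-y) := by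
  obtain ⟨r, hr, h⟩ := cong2_iff.1 h
  exact cong2_iff.2 ⟨-r, zTau.neg_mem hr, by linear_combination -h⟩

theorem cong2_mul {x y z w : ℝ} (hx : x ∈ zTau) (hw : w ∈ zTau)
    (h₁ : cong2 x y) (h₂ : cong2 z w) : cong2 (x * z) (y * w) := by
  obtain ⟨r, hr, h⟩ := cong2_iff.1 h₁
  obtain ⟨s, hs, k⟩ := cong2_iff.1 h₂
  exact cong2_iff.2 ⟨x * s + r * w, zTau.add_mem (zTau.mul_mem hx hs) (zTau.mul_mem hr hw),
    by linear_combination x * k + w * h⟩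

theorem cong2_sum {ι : Type*} (s : Finset ι) {f g : ι → ℝ} (h : ∀ i, cong2 (f i) (g i)) :
    cong2 (∑ i ∈ s, f i) (∑ i ∈ s, g i) := by
  choose r hr hfg using fun i => cong2_iff.1 (h i)
  refine cong2_iff.2 ⟨∑ i ∈ s, r i, zTau.sum_mem fun i _ => hr i, ?_⟩
  rw [← Finset.sum_sub_distrib, Finset.mul_sum]
  exact Finset.sum_congr rfl fun i _ => hfg i

theorem v4_mem_zTau {t : ℝ} (ht : t ∈ zTau) (i : Fin 4) : v4 t i ∈ zTau := by
  fin_cases i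
  · exact zTau.zero_mem
  · exact zTau.one_mem
  · exact zTau.sub_mem zTau.one_mem ht
  · exact ht

/-- Rational and `τ`-coordinates of `v4 gr`. -/
def v4Coord : Fin 4 → ℤ × ℤ := ![(0, 0), (1, 0), (1, -1), (0, 1)]

/-- Rational and `τ`-coordinates of `v4 (1 - gr)`. -/
def v4ConjCoord : Fin 4 → ℤ × ℤ := ![(0, 0), (1, 0), (0, 1), (1, -1)]

theorem v4_gr_eq (i : Fin 4) : v4 gr i = (v4Coord i).1 + (v4Coord i).2 * gr := by
  fin_cases i <;> simp [v4, v4Coord]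
  ring

theorem v4_conj_eq (i : Fin 4) :
    v4 (1 - gr) i = (v4ConjCoord i).1 + (v4ConjCoord i).2 * gr := by
  fin_cases i <;> simp [v4, v4ConjCoord]
  ring

/-- Multiplication of ℤ[τ] in coordinates. -/
def coordMul (p q : ℤ × ℤ) : ℤ × ℤ :=
  (p.1 * q.1 + p.2 * q.2, p.1 * q.2 + p.2 * q.1 + p.2 * q.2)

theorem coordMul_eq (p q : ℤ × ℤ) :
    ((coordMul p q).1 : ℝ) + (coordMul p q).2 * gr = (p.1 + p.2 * gr) * (q.1 + q.2 * gr) := by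
  simp only [coordMul]
  push_cast
  linear_combination (-(p.2 * q.2 : ℝ)) * gr_sq

theorem pairing_coord_ne_zero (π : Equiv.Perm (Fin 4)) (h : Equiv.Perm.sign π = 1) :
    ¬ (2 ∣ (∑ j, coordMul (v4Coord (π j)) (v4ConjCoord j)).1 ∧
      2 ∣ (∑ j, coordMul (v4Coord (π j)) (v4ConjCoord j)).2) := by
  revert π
  decide

theorem cong2_add_mul_gr {a b c d : ℤ} (h₁ : 2 ∣ a - c) (h₂ : 2 ∣ b - d) :
    cong2 (a + b * gr) (c + d * gr) := by
  obtain ⟨k, hk⟩ := h₁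
  obtain ⟨l, hl⟩ := h₂
  have hk' : (a : ℝ) - c = 2 * k := by exact_mod_cast hk
  have hl' : (b : ℝ) - d = 2 * l := by exact_mod_cast hl
  exact ⟨k, l, by linear_combination hk' + gr * hl'⟩

/-- Nonzero scalars of 𝔽₄ act on `v4 (1 - gr)` modulo 2 by even permutations. -/
theorem exists_even_perm_smul_v4 {a b : ℤ} (h : ¬ (2 ∣ a ∧ 2 ∣ b)) :
    ∃ κ : Equiv.Perm (Fin 4), Equiv.Perm.sign κ = 1 ∧
      ∀ j, cong2 (-((a + b * gr) * v4 (1 - gr) j)) (v4 (1 - gr) (κ j)) := by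
  suffices H : ∃ κ : Equiv.Perm (Fin 4), Equiv.Perm.sign κ = 1 ∧
      ∀ j, 2 ∣ -(coordMul (a, b) (v4ConjCoord j)).1 - (v4ConjCoord (κ j)).1 ∧
        2 ∣ -(coordMul (a, b) (v4ConjCoord j)).2 - (v4ConjCoord (κ j)).2 by
    obtain ⟨κ, hκ, H⟩ := H
    refine ⟨κ, hκ, fun j => ?_⟩
    have e := coordMul_eq (a, b) (v4ConjCoord j)
    rw [v4_conj_eq, v4_conj_eq]
    convert cong2_add_mul_gr (H j).1 (H j).2 using 1
    push_cast
    linear_combination e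
  have hc : (a % 2 = 1 ∧ b % 2 = 0) ∨ (a % 2 = 0 ∧ b % 2 = 1) ∨ (a % 2 = 1 ∧ b % 2 = 1) := by
    omega
  rcases hc with hc | hc | hc
  · refine ⟨1, by decide, fun j => ?_⟩
    fin_cases j <;> simp [coordMul, v4ConjCoord] <;> omega
  · refine ⟨Equiv.swap 1 2 * Equiv.swap 2 3, by decide, fun j => ?_⟩
    fin_cases j <;> simp [coordMul, v4ConjCoord, Equiv.swap_apply_def] <;> omega
  · refine ⟨Equiv.swap 2 3 * Equiv.swap 1 2, by decide, fun j => ?_⟩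
    fin_cases j <;> simp [coordMul, v4ConjCoord, Equiv.swap_apply_def] <;> omega

theorem exists_pairing_coord (ρ σ : Equiv.Perm (Fin 4)) (hρ : Equiv.Perm.sign ρ = 1)
    (hσ : Equiv.Perm.sign σ = 1) :
    ∃ a b : ℤ, ¬ (2 ∣ a ∧ 2 ∣ b) ∧
      ∑ i, v4 gr (ρ i) * v4 (1 - gr) (σ i) = a + b * gr := by
  refine ⟨_, _, pairing_coord_ne_zero (ρ * σ⁻¹) (by simp [hρ, hσ]), ?_⟩
  rw [← Equiv.sum_comp σ⁻¹]
  simp only [Prod.fst_sum, Prod.snd_sum, Int.cast_sum, Finset.sum_mul,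
    ← Finset.sum_add_distrib, coordMul_eq, ← v4_gr_eq, ← v4_conj_eq]
  simp

theorem sum_sq_reflv {α x : Fin 4 → ℝ} (hα : ∑ i, α i ^ 2 = 1) :
    ∑ i, reflv α x i ^ 2 = ∑ i, x i ^ 2 := by
  simp only [reflv, Fin.sum_univ_four] at *
  linear_combination 4 * (x 0 * α 0 + x 1 * α 1 + x 2 * α 2 + x 3 * α 3) ^ 2 * hα

theorem statement5 (α : Fin 4 → ℝ) (hα : α ∈ DeltaSet (1 - gr) \ Kset)
    (n : ℕ) (hn : 1 ≤ n) (x : Fin 4 → ℝ) (hx : x ∈ sphSdot gr n) :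
    reflv α x ∈ sphSdot (1 - gr) (n + 1) := by
  obtain ⟨hΔ, hK⟩ := hα
  obtain ⟨hx1, hxZ, ρ, hρ, hxρ⟩ := hx
  rcases hΔ with h | h | ⟨σ, hσ, ε, hε, h⟩
  · exact (hK ⟨Or.inl h, Or.inl h⟩).elim
  · exact (hK ⟨Or.inr (Or.inl h), Or.inr (Or.inl h)⟩).elim
  replace h : ∀ i, 2 * α i = ε i * v4 (1 - gr) (σ i) := fun i => by
    rw [h i, v4]
    ring
  have hε2 (i) : ε i ^ 2 = 1 := by rcases hε i with e | e <;> rw [e] <;> norm_num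
  have hv (i) : v4 (1 - gr) i ∈ zTau :=
    v4_mem_zTau (zTau.sub_mem zTau.one_mem gr_mem_zTau) i
  have hβ (i) : cong2 (2 * α i) (v4 (1 - gr) (σ i)) := by
    rw [h i]
    rcases hε i with e | e <;> rw [e]
    · rw [one_mul]
      exact cong2_refl _
    · exact cong2_iff.2 ⟨_, zTau.neg_mem (hv (σ i)), by ring⟩
  have hβZ (i) : 2 * α i ∈ zTau := by
    rw [h i]
    rcases hε i with e | e <;> rw [e]
    · exact zTau.mul_mem zTau.one_mem (hv _)
    · exact zTau.mul_mem (zTau.neg_mem zTau.one_mem) (hv _)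
  have hα1 : ∑ i, α i ^ 2 = 1 := by
    have e : ∑ i, α i ^ 2 = ∑ i, v4 (1 - gr) (σ i) ^ 2 / 4 :=
      Finset.sum_congr rfl fun i _ => by
        linear_combination (2 * α i + ε i * v4 (1 - gr) (σ i)) / 4 * h i +
          v4 (1 - gr) (σ i) ^ 2 / 4 * hε2 i
    rw [e, Equiv.sum_comp σ fun i => v4 (1 - gr) i ^ 2 / 4, Fin.sum_univ_four]
    simp [v4]
    linear_combination gr_sq / 2
  set S : ℝ := ∑ i, 2 ^ n * x i * (2 * α i) with hS
  have hSZ : S ∈ zTau := zTau.sum_mem fun i _ => zTau.mul_mem (hxZ i) (hβZ i)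
  have hrefl (i) : 2 ^ (n + 1) * reflv α x i = 2 * (2 ^ n * x i) - S * (2 * α i) := by
    have e : S = 2 ^ (n + 1) * ∑ j, x j * α j := by
      rw [hS, Finset.mul_sum]
      exact Finset.sum_congr rfl fun j _ => by ring
    rw [e, reflv]
    ring
  obtain ⟨a, b, hab, hpair⟩ := exists_pairing_coord ρ σ hρ hσ
  obtain ⟨κ, hκ, hκv⟩ := exists_even_perm_smul_v4 hab
  have hScong : cong2 S (a + b * gr) := by
    rw [← hpair]
    exact cong2_sum _ fun i => cong2_mul (hxZ i) (hv _) (hxρ i) (hβ i)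
  refine ⟨(sum_sq_reflv hα1).trans hx1, fun i => ?_, κ * σ, by simp [hκ, hσ], fun i => ?_⟩
  · rw [hrefl i, two_mul]
    exact zTau.sub_mem (zTau.add_mem (hxZ i) (hxZ i)) (zTau.mul_mem hSZ (hβZ i))
  · have h₁ : cong2 (2 ^ (n + 1) * reflv α x i) (-(S * (2 * α i))) :=
      cong2_iff.2 ⟨_, hxZ i, by rw [hrefl i]; ring⟩
    exact cong2_trans h₁ (cong2_trans (cong2_neg (cong2_mul hSZ (hv _) hScong (hβ i))) (hκv (σ i)))
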